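/- There exist a one-memory profile σ₁* ∈ Σ₁ and a vector v* ∈ ℝ^{[n]×S×Aⁿ} such that v* = V₁(σ₁*, σ₁*, v*) and, for every coordinate (i, s₁, p₀) ∈ [n] × S × Aⁿ, v*_{i,s₁,p₀} = max_{σ₁^i ∈ Σ₁^i} V₁(σ₁*, σ₁^i, v*)_{i,s₁,p₀}. -/

import Mathlib

open Finset

/-- A one-memory policy for a single firm. -/
def IsPolicy {ι S A : Type*} [Fintype A]
    (τ : (ι → A) → S → A → ℝ) : Prop :=
  (∀ p₀ s₁ a, 0 ≤ τ p₀ s₁ a) ∧ ∀ p₀ s₁, ∑ a, τ p₀ s₁ a = 1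

/-- A transition kernel on states. -/
def IsKernel {ι S A : Type*} [Fintype S]
    (P : (ι → A) → S → S → ℝ) : Prop :=
  (∀ p s s', 0 ≤ P p s s') ∧ ∀ p s, ∑ s', P p s s' = 1

/-- The one-step value operator `V₁`: in coordinate `(i, s₁, p₀)`, firm `i` plays the
policy `τ` while the other firms play according to the profile `σ`, and continuation
payoffs are given by `v`. -/
def V1 {ι S A : Type*} [Fintype ι] [DecidableEq ι] [Fintype S] [Fintype A]
    (P : (ι → A) → S → S → ℝ) (π : ι → (ι → A) → S → ℝ) (δ : ι → ℝ)
    (σ : ι → (ι → A) → S → A → ℝ) (τ : (ι → A) → S → A → ℝ)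
    (v : ι → S → (ι → A) → ℝ) (i : ι) (s₁ : S) (p₀ : ι → A) : ℝ :=
  ∑ p₁ : ι → A,
    (τ p₀ s₁ (p₁ i) * ∏ j ∈ Finset.univ.erase i, σ j p₀ s₁ (p₁ j)) *
      (π i p₁ s₁ + δ i * ∑ s₂, P p₁ s₁ s₂ * v i s₂ p₁)

theorem bw_small {I : Type*} [Fintype I] (f : (I → ℝ) → (I → ℝ)) (hf : ContDiff ℝ 1 f)
    (hc : HasCompactSupport f) (R : ℝ) (hR : ∀ x ∉ Metric.closedBall (0 : I → ℝ) R, f x = 0)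
    (φ : (I → ℝ) → ℝ) :
    ∃ ε > 0, ∀ t : ℝ, |t| < ε →
      ∫ x in Metric.closedBall (0 : I → ℝ) R,
        ((1 : (I → ℝ) →L[ℝ] (I → ℝ)) - t • fderiv ℝ f x).det * φ (x - t • f x) =
      ∫ x in Metric.closedBall (0 : I → ℝ) R, φ x := by
  obtain ⟨C, hC⟩ := (hc.fderiv ℝ).exists_bound_of_continuous (hf.continuous_fderiv one_ne_zero)
  obtain ⟨K, hK⟩ := hf.lipschitzWith_of_hasCompactSupport hc one_ne_zero
  have hdet : ∀ᶠ B in nhds (1 : (I → ℝ) →L[ℝ] (I → ℝ)), 0 < B.det := by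
    have := (ContinuousLinearMap.continuous_det (𝕜 := ℝ) (E := I → ℝ)).continuousAt
      (x := (1 : (I → ℝ) →L[ℝ] (I → ℝ)))
    apply this.eventually (lt_mem_nhds _)
    simp [ContinuousLinearMap.det]
  obtain ⟨η, hη, hdet⟩ := Metric.eventually_nhds_iff.1 hdet
  have hC0 : 0 ≤ C := (norm_nonneg _).trans (hC 0)
  refine ⟨min (η / (C + 1)) (1 / (K + 1)), by positivity, fun t ht => ?_⟩
  have ht1 : |t| * (C + 1) < η := (lt_div_iff₀ (by positivity)).1 (ht.trans_le (min_le_left _ _))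
  have ht2 : |t| * (K + 1) < 1 := (lt_div_iff₀ (by positivity)).1 (ht.trans_le (min_le_right _ _))
  have hpos : ∀ x, 0 < ((1 : (I → ℝ) →L[ℝ] (I → ℝ)) - t • fderiv ℝ f x).det := by
    intro x
    apply hdet
    rw [dist_eq_norm, sub_sub_cancel_left, norm_neg, norm_smul, Real.norm_eq_abs]
    nlinarith [hC x, abs_nonneg t]
  set g : (I → ℝ) → (I → ℝ) := fun x => x - t • f x with hg
  have hcontr : ∀ y, ContractingWith (⟨|t|, abs_nonneg t⟩ * K) (fun x => y + t • f x) := by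
    intro y
    refine ⟨?_, ?_⟩
    · rw [← NNReal.coe_lt_coe]
      change |t| * K < 1
      nlinarith [abs_nonneg t]
    · apply LipschitzWith.of_dist_le_mul
      intro a b
      rw [dist_add_left, dist_smul₀, Real.norm_eq_abs]
      push_cast
      change _ ≤ |t| * K * _
      rw [mul_assoc]
      exact mul_le_mul_of_nonneg_left (hK.dist_le_mul a b) (abs_nonneg t)
  have hinj : Function.Injective g := by
    intro a b hab
    apply (hcontr (g a)).fixedPoint_unique' (x := a) (y := b)
    · simp [Function.IsFixedPt, hg]
    · rw [hab]; simp [Function.IsFixedPt, hg]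
  have hsurj : Function.Surjective g := by
    intro y
    refine ⟨(hcontr y).fixedPoint, ?_⟩
    have := (hcontr y).fixedPoint_isFixedPt
    rw [Function.IsFixedPt] at this
    simp only [hg]
    nth_rewrite 1 [← this]
    simp
  have hout : ∀ x ∉ Metric.closedBall (0 : I → ℝ) R, g x = x := by
    intro x hx; simp [hg, hR x hx]
  have himg : g '' Metric.closedBall (0 : I → ℝ) R = Metric.closedBall (0 : I → ℝ) R := by
    ext y
    constructor
    · rintro ⟨x, hx, rfl⟩
      by_contra h
      have := hinj (hout _ h)
      rw [this] at h
      exact h hx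
    · intro hy
      obtain ⟨x, rfl⟩ := hsurj y
      refine ⟨x, ?_, rfl⟩
      by_contra h
      rw [hout x h] at hy
      exact h hy
  have hder : ∀ x ∈ Metric.closedBall (0 : I → ℝ) R, HasFDerivWithinAt g
      ((1 : (I → ℝ) →L[ℝ] (I → ℝ)) - t • fderiv ℝ f x) (Metric.closedBall (0 : I → ℝ) R) x := by
    intro x _
    apply HasFDerivAt.hasFDerivWithinAt
    exact (hasFDerivAt_id x).sub
      (((hf.differentiable one_ne_zero) x).hasFDerivAt.const_smul t)
  have := MeasureTheory.integral_image_eq_integral_abs_det_fderiv_smul MeasureTheory.volume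
    (Metric.isClosed_closedBall.measurableSet) hder hinj.injOn φ
  rw [himg] at this
  rw [this]
  congr 1
  ext x
  rw [abs_of_pos (hpos x), smul_eq_mul]

theorem bw_det_poly {I : Type*} [Fintype I] (L : (I → ℝ) →L[ℝ] (I → ℝ)) :
    ∃ p : Polynomial ℝ, p.natDegree ≤ Fintype.card I ∧
      ∀ t : ℝ, p.eval t = ((1 : (I → ℝ) →L[ℝ] (I → ℝ)) - t • L).det := by
  classical
  let M : Matrix I I ℝ := LinearMap.toMatrix' (L : (I → ℝ) →ₗ[ℝ] (I → ℝ))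
  refine ⟨_, Polynomial.natDegree_det_X_add_C_le (-M) 1, fun t => ?_⟩
  rw [← Polynomial.coe_evalRingHom, RingHom.map_det, ContinuousLinearMap.det, ← LinearMap.det_toMatrix']
  congr 1
  ext i j
  simp [M, LinearMap.toMatrix'_apply, Matrix.one_apply, Pi.single_apply]
  split_ifs <;> simp <;> ring

theorem bw_key {I : Type*} [Fintype I] (f : (I → ℝ) → (I → ℝ)) (hf : ContDiff ℝ 1 f)
    (hc : HasCompactSupport f) (R : ℝ) (hR : ∀ x ∉ Metric.closedBall (0 : I → ℝ) R, f x = 0)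
    (φ : (I → ℝ) → ℝ) (hφ : Continuous φ) (N : ℕ)
    (hp : ∀ x, ∃ p : Polynomial ℝ, p.natDegree ≤ N ∧ ∀ t : ℝ, p.eval t = φ (x - t • f x)) :
    ∫ x in Metric.closedBall (0 : I → ℝ) R,
        ((1 : (I → ℝ) →L[ℝ] (I → ℝ)) - fderiv ℝ f x).det * φ (x - f x) =
      ∫ x in Metric.closedBall (0 : I → ℝ) R, φ x := by
  obtain ⟨ε, hε, h⟩ := bw_small f hf hc R hR φ
  set n := Fintype.card I + N + 1 with hn
  let v : ℕ → ℝ := fun k => ε / (k + 2)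
  have hv : Set.InjOn v (Finset.range n) := by
    intro a _ b _ hab
    simp only [v] at hab
    rw [div_eq_div_iff (by positivity) (by positivity)] at hab
    have := mul_left_cancel₀ hε.ne' hab
    have : (b : ℝ) = a := by linarith
    exact_mod_cast this.symm
  have hvε : ∀ k, |v k| < ε := by
    intro k
    have : 0 < v k := by positivity
    rw [abs_of_pos this, div_lt_iff₀ (by positivity)]
    have : (0 : ℝ) ≤ k := by positivity
    nlinarith
  set H : ℝ → (I → ℝ) → ℝ := fun t x =>
    ((1 : (I → ℝ) →L[ℝ] (I → ℝ)) - t • fderiv ℝ f x).det * φ (x - t • f x) with hH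
  have hHc : ∀ t, Continuous (H t) := by
    intro t
    have h1 := hf.continuous_fderiv one_ne_zero
    have h2 := hf.continuous
    refine Continuous.mul (ContinuousLinearMap.continuous_det.comp ?_) (hφ.comp ?_)
    · exact continuous_const.sub (h1.const_smul t)
    · exact continuous_id.sub (h2.const_smul t)
  have hHi : ∀ t, MeasureTheory.IntegrableOn (H t) (Metric.closedBall (0 : I → ℝ) R) := fun t =>
    (hHc t).continuousOn.integrableOn_compact (isCompact_closedBall _ _)
  have hLag : ∀ p : Polynomial ℝ, p.natDegree < n → p.eval 1 =
      ∑ k ∈ Finset.range n, p.eval (v k) * (Lagrange.basis (Finset.range n) v k).eval 1 := by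
    intro p hpn
    have : p.degree < #(Finset.range n) := by
      rw [Finset.card_range]
      exact Polynomial.degree_le_natDegree.trans_lt (by exact_mod_cast hpn)
    conv_lhs => rw [Lagrange.eq_interpolate hv this]
    simp [Lagrange.interpolate_apply, Polynomial.eval_finsetSum]
  have hHL : ∀ x, H 1 x =
      ∑ k ∈ Finset.range n, H (v k) x * (Lagrange.basis (Finset.range n) v k).eval 1 := by
    intro x
    obtain ⟨p, hp1, hp2⟩ := hp x
    obtain ⟨q, hq1, hq2⟩ := bw_det_poly (fderiv ℝ f x)
    have he : ∀ t, H t x = (q * p).eval t := by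
      intro t; simp [hH, hp2, hq2]
    simp only [he]
    apply hLag
    exact Polynomial.natDegree_mul_le.trans_lt (by omega)
  have hone : ∑ k ∈ Finset.range n, (Lagrange.basis (Finset.range n) v k).eval 1 = 1 := by
    have := hLag 1 (by simp [hn])
    simpa using this.symm
  have e1 : ∫ x in Metric.closedBall (0 : I → ℝ) R, H 1 x =
      ∫ x in Metric.closedBall (0 : I → ℝ) R, φ x := by
    simp only [hHL]
    rw [MeasureTheory.integral_finsetSum _ (fun k _ => (hHi (v k)).mul_const _)]
    simp only [MeasureTheory.integral_mul_const]
    have : ∀ k, ∫ x in Metric.closedBall (0 : I → ℝ) R, H (v k) x =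
      ∫ x in Metric.closedBall (0 : I → ℝ) R, φ x := fun k => h _ (hvε k)
    simp only [this]
    rw [← Finset.mul_sum, hone, mul_one]
  simpa [hH] using e1

theorem bw_smooth {I : Type*} [Fintype I] (f : (I → ℝ) → (I → ℝ)) (hf : ContDiff ℝ 1 f)
    (hc : HasCompactSupport f) : ∃ x, f x = x := by
  by_contra! hne
  obtain ⟨R, hR0, hR⟩ : ∃ R > 0, ∀ x ∉ Metric.closedBall (0 : I → ℝ) R, f x = 0 := by
    obtain ⟨R, hR⟩ := hc.isCompact.isBounded.subset_closedBall 0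
    refine ⟨max R 1, by positivity, fun x hx => ?_⟩
    by_contra h
    exact hx (Metric.closedBall_subset_closedBall (le_max_left _ _) (hR (subset_tsupport _ h)))
  set B := Metric.closedBall (0 : I → ℝ) R with hB
  have hBc : IsCompact B := isCompact_closedBall _ _
  have h0B : (0 : I → ℝ) ∈ B := by simp [hB, hR0.le]
  let q : (I → ℝ) → ℝ := fun y => ∑ i, y i ^ 2
  have hq : Continuous q := by fun_prop
  have hq0 : ∀ y, 0 ≤ q y := fun y => Finset.sum_nonneg fun i _ => sq_nonneg _
  have hgc : Continuous (fun x => x - f x) := continuous_id.sub hf.continuous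
  have hqg : Continuous (fun x => q (x - f x)) := hq.comp hgc
  obtain ⟨x0, _, hx0⟩ := hBc.exists_isMinOn ⟨0, h0B⟩ hqg.continuousOn
  set ε := q (x0 - f x0) with hε
  have hεpos : 0 < ε := by
    refine lt_of_le_of_ne (hq0 _) fun h => hne x0 ?_
    have := (Finset.sum_eq_zero_iff_of_nonneg (fun i _ => sq_nonneg _)).1 h.symm
    ext i
    have := this i (Finset.mem_univ i)
    simp at this
    linarith
  obtain ⟨x1, _, hx1⟩ := hBc.exists_isMaxOn ⟨0, h0B⟩ hqg.continuousOn
  obtain ⟨x2, _, hx2⟩ := hBc.exists_isMaxOn ⟨0, h0B⟩ hq.continuousOn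
  set M := max (q (x1 - f x1)) (q x2) with hM
  have hM1 : ∀ x ∈ B, q (x - f x) ≤ M := fun x hx => (hx1 hx).trans (le_max_left _ _)
  have hM2 : ∀ x ∈ B, q x ≤ M := fun x hx => (hx2 hx).trans (le_max_right _ _)
  have hm : ∀ x ∈ B, ε ≤ q (x - f x) := fun x hx => hx0 hx
  have hεM : ε ≤ M := (hm 0 h0B).trans (hM1 0 h0B)
  have hMpos : 0 < M := hεpos.trans_le hεM
  set D : (I → ℝ) → ℝ := fun x => ((1 : (I → ℝ) →L[ℝ] (I → ℝ)) - fderiv ℝ f x).det with hD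
  have hDc : Continuous D := ContinuousLinearMap.continuous_det.comp
    (continuous_const.sub (hf.continuous_fderiv one_ne_zero))
  set U := {x | q x < ε / 2} ∩ Metric.ball (0 : I → ℝ) R with hU
  have hUo : IsOpen U := (isOpen_lt hq continuous_const).inter Metric.isOpen_ball
  have hUB : U ⊆ B := fun x hx => Metric.ball_subset_closedBall hx.2
  have hUv : 0 < MeasureTheory.volume.real U := by
    have h1 : MeasureTheory.volume U ≠ 0 := (hUo.measure_pos _ ⟨0, by simp [hU, q, hεpos, hR0]⟩).ne'
    have h2 : MeasureTheory.volume U ≠ ⊤ :=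
      ((MeasureTheory.measure_mono hUB).trans_lt hBc.measure_lt_top).ne
    exact ENNReal.toReal_pos h1 h2
  have hint : ∀ {F : (I → ℝ) → ℝ}, Continuous F → MeasureTheory.IntegrableOn F B := fun h =>
    h.continuousOn.integrableOn_compact hBc
  have main : ∀ k : ℕ, MeasureTheory.volume.real U * (1 - ε / (2 * M)) ^ k ≤
      (∫ x in B, |D x|) * (1 - ε / M) ^ k := by
    intro k
    let φ : (I → ℝ) → ℝ := fun y => (1 - q y / M) ^ k
    have hφ : Continuous φ := by fun_prop
    have key := bw_key f hf hc R hR φ hφ (2 * k) (by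
      intro x
      let r : Polynomial ℝ := 1 - (∑ i, (Polynomial.C (x i) - Polynomial.C (f x i) * Polynomial.X) ^ 2) * Polynomial.C M⁻¹
      refine ⟨r ^ k, ?_, ?_⟩
      · have : r.natDegree ≤ 2 := by
          refine (Polynomial.natDegree_sub_le _ _).trans (max_le (by simp) ?_)
          refine (Polynomial.natDegree_mul_C_le _ _).trans ?_
          refine Polynomial.natDegree_sum_le_of_forall_le _ _ fun i _ => ?_
          refine Polynomial.natDegree_pow_le.trans ?_
          have : (Polynomial.C (x i) - Polynomial.C (f x i) * Polynomial.X).natDegree ≤ 1 := by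
            compute_degree
          omega
        refine Polynomial.natDegree_pow_le.trans ?_
        nlinarith
      · intro t
        have hcm : ∀ i, f x i * t = t * f x i := fun i => mul_comm _ _
        simp [r, φ, q, Polynomial.eval_finsetSum, div_eq_mul_inv, hcm])
    have l1 : ∫ x in B, D x * φ (x - f x) ≤ ∫ x in B, |D x| * (1 - ε / M) ^ k := by
      refine MeasureTheory.setIntegral_mono_on (hint (hDc.mul (hφ.comp hgc)))
        (hint (hDc.abs.mul continuous_const)) hBc.measurableSet fun x hx => ?_
      have a1 : 0 ≤ 1 - q (x - f x) / M := by
        rw [sub_nonneg, div_le_one hMpos]; exact hM1 x hx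
      have a2 : 1 - q (x - f x) / M ≤ 1 - ε / M := by
        have := hm x hx
        gcongr
      have a3 : φ (x - f x) ≤ (1 - ε / M) ^ k := pow_le_pow_left₀ a1 a2 k
      have a4 : 0 ≤ φ (x - f x) := pow_nonneg a1 k
      calc D x * φ (x - f x) ≤ |D x| * φ (x - f x) := by gcongr; exact le_abs_self _
        _ ≤ _ := by gcongr
    have l2 : ∫ x in U, (1 - ε / (2 * M)) ^ k ≤ ∫ x in U, φ x := by
      refine MeasureTheory.setIntegral_mono_on ((hint continuous_const).mono_set hUB)
        ((hint hφ).mono_set hUB) hUo.measurableSet fun x hx => ?_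
      have b1 : 0 ≤ 1 - ε / (2 * M) := by
        rw [sub_nonneg, div_le_one (by positivity)]; linarith
      refine pow_le_pow_left₀ b1 ?_ k
      have : q x < ε / 2 := hx.1
      have : q x / M ≤ ε / 2 / M := by gcongr
      rw [div_div] at this
      linarith
    have l3 : ∫ x in U, φ x ≤ ∫ x in B, φ x := by
      refine MeasureTheory.setIntegral_mono_set (hint hφ) ?_ (Filter.Eventually.of_forall hUB)
      refine (MeasureTheory.ae_restrict_iff' hBc.measurableSet).2 (Filter.Eventually.of_forall fun x hx => ?_)
      apply pow_nonneg
      rw [sub_nonneg, div_le_one hMpos]; exact hM2 x hx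
    rw [MeasureTheory.setIntegral_const, smul_eq_mul] at l2
    rw [MeasureTheory.integral_mul_const] at l1
    exact l2.trans (l3.trans (key.symm.le.trans l1))
  set a := 1 - ε / M
  set b := 1 - ε / (2 * M)
  have ha : 0 ≤ a := by
    simp only [a]; rw [sub_nonneg, div_le_one hMpos]; exact hεM
  have hab : a < b := by
    simp only [a, b]
    have : ε / (2 * M) < ε / M := by gcongr; linarith
    linarith
  have hb : 0 < b := ha.trans_lt hab
  have lim : Filter.Tendsto (fun k : ℕ => (∫ x in B, |D x|) * (a / b) ^ k) Filter.atTop (nhds ((∫ x in B, |D x|) * 0)) :=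
    (tendsto_pow_atTop_nhds_zero_of_lt_one (by positivity) ((div_lt_one hb).2 hab)).const_mul _
  rw [mul_zero] at lim
  have := ge_of_tendsto' lim (b := MeasureTheory.volume.real U) fun k => by
    rw [div_pow, ← mul_div_assoc, le_div_iff₀ (by positivity)]
    exact main k
  linarith

theorem bw_bounded {I : Type*} [Fintype I] (f : (I → ℝ) → (I → ℝ)) (hf : Continuous f)
    (R : ℝ) (hR : ∀ x, ‖f x‖ ≤ R) : ∃ x, f x = x := by
  by_contra! hne
  have hR0 : 0 ≤ R := (norm_nonneg _).trans (hR 0)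
  let χ : ContDiffBump (0 : I → ℝ) := ⟨R + 1, R + 2, by linarith, by linarith⟩
  let h : (I → ℝ) → (I → ℝ) := fun x => χ x • f x
  have hh : Continuous h := χ.continuous.smul hf
  have hs : HasCompactSupport h := χ.hasCompactSupport.smul_right
  have hhR : ∀ x, ‖h x‖ ≤ R := by
    intro x
    simp only [h]
    rw [norm_smul, Real.norm_eq_abs, abs_of_nonneg χ.nonneg]
    have := hR x
    nlinarith [χ.le_one (x := x), χ.nonneg (x := x), norm_nonneg (f x)]
  have hne' : ∀ x, x - h x ≠ 0 := by
    intro x hx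
    have e : x = h x := sub_eq_zero.1 hx
    have : χ x = 1 := by
      apply χ.one_of_mem_closedBall
      have := hhR x
      rw [← e] at this
      simp [χ]; linarith
    simp only [h, this, one_smul] at e
    exact hne x e.symm
  obtain ⟨x0, _, hx0⟩ := (isCompact_closedBall (0 : I → ℝ) (R + 1)).exists_isMinOn
    ⟨0, by simp; linarith⟩ ((continuous_id.sub hh).norm).continuousOn
  set ε := ‖x0 - h x0‖ with hε
  have hεp : 0 < ε := norm_pos_iff.2 (hne' x0)
  obtain ⟨g, hg, hgd, hgs⟩ := hh.exists_contDiff_approx 1 (ε := fun _ => min ε 1) continuous_const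
    (fun _ => by positivity)
  obtain ⟨x, hx⟩ := bw_smooth g (by exact_mod_cast hg) (hs.mono hgs)
  have h1 := hgd x
  rw [hx, dist_eq_norm] at h1
  have h2 : ‖x‖ ≤ R + 1 := by
    have := hhR x
    have h3 : ‖x - h x‖ < 1 := h1.trans_le (min_le_right _ _)
    have := norm_sub_norm_le x (h x)
    linarith
  have h4 : ε ≤ ‖x - h x‖ := hx0 (by simpa using h2)
  exact absurd (h1.trans_le (min_le_left _ _)) (not_lt.2 h4)

theorem V1_linear {ι S A : Type*} [Fintype ι] [DecidableEq ι] [Fintype S] [Fintype A]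
    [DecidableEq A]
    (P : (ι → A) → S → S → ℝ) (π : ι → (ι → A) → S → ℝ) (δ : ι → ℝ)
    (σ : ι → (ι → A) → S → A → ℝ) (τ : (ι → A) → S → A → ℝ)
    (v : ι → S → (ι → A) → ℝ) (i : ι) (s₁ : S) (p₀ : ι → A) :
    V1 P π δ σ τ v i s₁ p₀ =
      ∑ a, τ p₀ s₁ a * V1 P π δ σ (fun _ _ b => if b = a then 1 else 0) v i s₁ p₀ := by
  simp only [V1, Finset.mul_sum]
  rw [Finset.sum_comm]
  refine Finset.sum_congr rfl fun p₁ _ => ?_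
  rw [Finset.sum_eq_single (p₁ i)]
  · simp only [if_true]; ring
  · intro b _ hb
    simp [hb.symm]
  · simp

theorem V1_bound {ι S A : Type*} [Fintype ι] [DecidableEq ι] [Fintype S] [Fintype A]
    (P : (ι → A) → S → S → ℝ) (hP : IsKernel P) (π : ι → (ι → A) → S → ℝ) (δ : ι → ℝ)
    (hδ : ∀ i, 0 < δ i ∧ δ i < 1)
    (σ : ι → (ι → A) → S → A → ℝ) (hσ : ∀ j, IsPolicy (σ j))
    (v : ι → S → (ι → A) → ℝ) (C : ℝ) (hC : ∀ i p s, |π i p s| ≤ C)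
    (hv : ∀ i s p, |v i s p| ≤ C / (1 - δ i)) (i : ι) (s₁ : S) (p₀ : ι → A) :
    |V1 P π δ σ (σ i) v i s₁ p₀| ≤ C / (1 - δ i) := by
  have hd : 0 < 1 - δ i := by linarith [(hδ i).2]
  set M := C / (1 - δ i) with hM
  have hCM : C + δ i * M = M := by rw [hM]; field_simp; ring
  have hw : ∀ p₁ : ι → A, σ i p₀ s₁ (p₁ i) * ∏ j ∈ Finset.univ.erase i, σ j p₀ s₁ (p₁ j) =
      ∏ j, σ j p₀ s₁ (p₁ j) := fun p₁ =>
    Finset.mul_prod_erase Finset.univ (fun j => σ j p₀ s₁ (p₁ j)) (Finset.mem_univ i)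
  have hsum : ∑ p₁ : ι → A, ∏ j, σ j p₀ s₁ (p₁ j) = 1 := by
    rw [← Fintype.prod_sum (fun j a => σ j p₀ s₁ a)]
    simp [(hσ _).2]
  have hu : ∀ p₁, |π i p₁ s₁ + δ i * ∑ s₂, P p₁ s₁ s₂ * v i s₂ p₁| ≤ M := by
    intro p₁
    have h1 : |∑ s₂, P p₁ s₁ s₂ * v i s₂ p₁| ≤ M := by
      calc |∑ s₂, P p₁ s₁ s₂ * v i s₂ p₁| ≤ ∑ s₂, |P p₁ s₁ s₂ * v i s₂ p₁| :=
            Finset.abs_sum_le_sum_abs _ _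
        _ ≤ ∑ s₂, P p₁ s₁ s₂ * M := by
            refine Finset.sum_le_sum fun s₂ _ => ?_
            rw [abs_mul, abs_of_nonneg (hP.1 _ _ _)]
            exact mul_le_mul_of_nonneg_left (hv _ _ _) (hP.1 _ _ _)
        _ = M := by rw [← Finset.sum_mul, hP.2, one_mul]
    calc _ ≤ |π i p₁ s₁| + |δ i * ∑ s₂, P p₁ s₁ s₂ * v i s₂ p₁| := abs_add_le _ _
      _ ≤ C + δ i * M := by
          rw [abs_mul, abs_of_pos (hδ i).1]
          exact add_le_add (hC _ _ _) (mul_le_mul_of_nonneg_left h1 (hδ i).1.le)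
      _ = M := hCM
  simp only [V1, hw]
  calc _ ≤ ∑ p₁ : ι → A, |(∏ j, σ j p₀ s₁ (p₁ j)) *
          (π i p₁ s₁ + δ i * ∑ s₂, P p₁ s₁ s₂ * v i s₂ p₁)| := Finset.abs_sum_le_sum_abs _ _
    _ ≤ ∑ p₁ : ι → A, (∏ j, σ j p₀ s₁ (p₁ j)) * M := by
        refine Finset.sum_le_sum fun p₁ _ => ?_
        have h0 : 0 ≤ ∏ j, σ j p₀ s₁ (p₁ j) := Finset.prod_nonneg fun j _ => (hσ j).1 _ _ _
        rw [abs_mul, abs_of_nonneg h0]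
        exact mul_le_mul_of_nonneg_left (hu p₁) h0
    _ = M := by rw [← Finset.sum_mul, hsum, one_mul]

/-- Retraction of `A → ℝ` onto the simplex. -/
noncomputable def simplexRetr {A : Type*} [Fintype A] (x : A → ℝ) (a : A) : ℝ :=
  (max 0 (x a) + max 0 (1 - ∑ b, max 0 (x b)) / Fintype.card A) / max 1 (∑ b, max 0 (x b))

theorem simplexRetr_nonneg {A : Type*} [Fintype A] (x : A → ℝ) (a : A) :
    0 ≤ simplexRetr x a := by
  unfold simplexRetr; positivity

theorem simplexRetr_sum {A : Type*} [Fintype A] [Nonempty A] (x : A → ℝ) :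
    ∑ a, simplexRetr x a = 1 := by
  unfold simplexRetr
  have hA : (Fintype.card A : ℝ) ≠ 0 := by simp
  rw [← Finset.sum_div, Finset.sum_add_distrib, Finset.sum_const, Finset.card_univ, nsmul_eq_mul,
    mul_div_cancel₀ _ hA, div_eq_one_iff_eq (by positivity)]
  rcases le_total (∑ b, max 0 (x b)) 1 with h | h
  · rw [max_eq_left h, max_eq_right (by linarith)]; ring
  · rw [max_eq_right h, max_eq_left (by linarith)]; ring

theorem simplexRetr_eq {A : Type*} [Fintype A] (x : A → ℝ) (h0 : ∀ a, 0 ≤ x a)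
    (h1 : ∑ a, x a = 1) : simplexRetr x = x := by
  ext a
  simp [simplexRetr, h0, h1]

theorem simplexRetr_continuous {A : Type*} [Fintype A] (a : A) :
    Continuous (fun x : A → ℝ => simplexRetr x a) := by
  unfold simplexRetr
  refine Continuous.div (by fun_prop) (by fun_prop) fun x => ?_
  positivity

/-- Fink: there exist a one-memory profile `σ*` and a payoff vector `v*`
with `v* = V₁(σ*, σ*, v*)` and, coordinatewise, `v*` is the maximum of
`V₁(σ*, ·, v*)` over one-memory policies of firm `i`. -/
theorem exists_stationary_point
    {ι S A : Type*} [Fintype ι] [DecidableEq ι] [Nonempty ι]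
    [Fintype S] [DecidableEq S] [Nonempty S]
    [Fintype A] [DecidableEq A] [Nonempty A]
    (P : (ι → A) → S → S → ℝ) (hP : IsKernel P)
    (π : ι → (ι → A) → S → ℝ)
    (δ : ι → ℝ) (hδ : ∀ i, 0 < δ i ∧ δ i < 1) :
    ∃ (σ : ι → (ι → A) → S → A → ℝ) (v : ι → S → (ι → A) → ℝ),
      (∀ j, IsPolicy (σ j)) ∧
      (∀ i s₁ p₀, v i s₁ p₀ = V1 P π δ σ (σ i) v i s₁ p₀) ∧
      (∀ i s₁ p₀ (τ : (ι → A) → S → A → ℝ), IsPolicy τ →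
        V1 P π δ σ τ v i s₁ p₀ ≤ v i s₁ p₀) := by
  obtain ⟨C, hC⟩ : ∃ C, ∀ i p s, |π i p s| ≤ C := by
    obtain ⟨C, hC⟩ := (Set.finite_range
      (fun x : ι × (ι → A) × S => |π x.1 x.2.1 x.2.2|)).bddAbove
    exact ⟨C, fun i p s => hC ⟨(i, p, s), rfl⟩⟩
  have hC0 : 0 ≤ C := (abs_nonneg _).trans
    (hC (Classical.arbitrary ι) (fun _ => Classical.arbitrary A) (Classical.arbitrary S))
  let I := (ι × (ι → A) × S × A) ⊕ (ι × S × (ι → A))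
  let M : ι → ℝ := fun i => C / (1 - δ i)
  have hM : ∀ i, 0 ≤ M i := fun i => div_nonneg hC0 (by linarith [(hδ i).2])
  let Sg : (I → ℝ) → ι → (ι → A) → S → A → ℝ := fun z i p s a =>
    simplexRetr (fun b => z (Sum.inl (i, p, s, b))) a
  let Vv : (I → ℝ) → ι → S → (ι → A) → ℝ := fun z i s p =>
    max (-M i) (min (M i) (z (Sum.inr (i, s, p))))
  have hSgc : ∀ i p s a, Continuous fun z => Sg z i p s a := fun i p s a =>
    (simplexRetr_continuous a).comp
      (g := fun x : A → ℝ => simplexRetr x a)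
      (f := fun (z : I → ℝ) (b : A) => z (Sum.inl (i, p, s, b)))
      (continuous_pi fun b => continuous_apply _)
  have hVvc : ∀ i s p, Continuous fun z => Vv z i s p := fun i s p => by
    simp only [Vv]; fun_prop
  have hSgp : ∀ z j, IsPolicy (Sg z j) := fun z j =>
    ⟨fun _ _ _ => simplexRetr_nonneg _ _, fun _ _ => simplexRetr_sum _⟩
  have hVvb : ∀ z i s p, |Vv z i s p| ≤ M i := fun z i s p => by
    rw [abs_le]
    exact ⟨le_max_left _ _, max_le (by linarith [hM i]) (min_le_left _ _)⟩
  let pt : A → (ι → A) → S → A → ℝ := fun a _ _ b => if b = a then 1 else 0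
  let W : (I → ℝ) → ι → S → (ι → A) → ℝ := fun z i s p => V1 P π δ (Sg z) (Sg z i) (Vv z) i s p
  let Q : (I → ℝ) → ι → S → (ι → A) → A → ℝ := fun z i s p a =>
    V1 P π δ (Sg z) (pt a) (Vv z) i s p
  have hWc : ∀ i s p, Continuous fun z => W z i s p := fun i s p => by
    simp only [W, V1]; fun_prop
  have hQc : ∀ i s p a, Continuous fun z => Q z i s p a := fun i s p a => by
    simp only [Q, V1]; fun_prop
  let G : (I → ℝ) → ι → S → (ι → A) → A → ℝ := fun z i s p a => max 0 (Q z i s p a - W z i s p)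
  have hG0 : ∀ z i s p a, 0 ≤ G z i s p a := fun _ _ _ _ _ => le_max_left _ _
  have hGs0 : ∀ z i s p, 0 ≤ ∑ a, G z i s p a := fun z i s p =>
    Finset.sum_nonneg fun a _ => hG0 z i s p a
  have hGc : ∀ i s p a, Continuous fun z => G z i s p a := fun i s p a => by
    simp only [G]; fun_prop
  let F : (I → ℝ) → I → ℝ := fun z => Sum.elim
    (fun x => (Sg z x.1 x.2.1 x.2.2.1 x.2.2.2 + G z x.1 x.2.2.1 x.2.1 x.2.2.2) /
      (1 + ∑ b, G z x.1 x.2.2.1 x.2.1 b))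
    (fun y => W z y.1 y.2.1 y.2.2)
  have hFc : Continuous F := by
    refine continuous_pi fun x => ?_
    rcases x with ⟨i, p, s, a⟩ | ⟨i, s, p⟩
    · simp only [F, Sum.elim_inl]
      refine Continuous.div (by fun_prop) (by fun_prop) fun z => ?_
      linarith [hGs0 z i s p]
    · simp only [F, Sum.elim_inr]
      fun_prop
  have hF0 : ∀ z i p s a, 0 ≤ F z (Sum.inl (i, p, s, a)) := fun z i p s a =>
    div_nonneg (add_nonneg ((hSgp z i).1 _ _ _) (hG0 _ _ _ _ _)) (by linarith [hGs0 z i s p])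
  have hF1 : ∀ z i p s, ∑ a, F z (Sum.inl (i, p, s, a)) = 1 := fun z i p s => by
    simp only [F, Sum.elim_inl]
    rw [← Finset.sum_div, Finset.sum_add_distrib, (hSgp z i).2, div_self]
    linarith [hGs0 z i s p]
  have hFW : ∀ z i s p, |W z i s p| ≤ M i := fun z i s p =>
    V1_bound P hP π δ hδ (Sg z) (hSgp z) (Vv z) C hC (hVvb z) i s p
  have hFb : ∀ z, ‖F z‖ ≤ 1 + ∑ i, M i := by
    intro z
    have hMs : 0 ≤ ∑ i, M i := Finset.sum_nonneg fun i _ => hM i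
    refine (pi_norm_le_iff_of_nonneg (by linarith)).2 fun x => ?_
    rcases x with ⟨i, p, s, a⟩ | ⟨i, s, p⟩
    · rw [Real.norm_eq_abs, abs_of_nonneg (hF0 z i p s a)]
      have := Finset.single_le_sum (f := fun a => F z (Sum.inl (i, p, s, a)))
        (fun b _ => hF0 z i p s b) (Finset.mem_univ a)
      rw [hF1] at this
      linarith
    · have h1 : ‖F z (Sum.inr (i, s, p))‖ ≤ M i := hFW z i s p
      have := Finset.single_le_sum (f := M) (fun b _ => hM b) (Finset.mem_univ i)
      linarith
  obtain ⟨z, hz⟩ := bw_bounded F hFc _ hFb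
  have hSz : ∀ i p s a, Sg z i p s a = z (Sum.inl (i, p, s, a)) := by
    intro i p s a
    refine congrFun (simplexRetr_eq (fun b => z (Sum.inl (i, p, s, b))) ?_ ?_) a
    · intro a
      have := hF0 z i p s a
      rwa [hz] at this
    · have := hF1 z i p s
      rwa [hz] at this
  have hVz : ∀ i s p, Vv z i s p = W z i s p := by
    intro i s p
    have h1 : W z i s p = z (Sum.inr (i, s, p)) := congrFun hz (Sum.inr (i, s, p))
    have h2 := abs_le.1 (hFW z i s p)
    simp only [Vv]
    rw [← h1, min_eq_right h2.2, max_eq_right h2.1]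
  have hlin : ∀ i s p (τ : (ι → A) → S → A → ℝ), V1 P π δ (Sg z) τ (Vv z) i s p =
      ∑ a, τ p s a * Q z i s p a := fun i s p τ => V1_linear P π δ (Sg z) τ (Vv z) i s p
  have hopt : ∀ i s p a, Q z i s p a ≤ W z i s p := by
    intro i s p
    have e1 : ∀ a, Sg z i p s a * ∑ b, G z i s p b = G z i s p a := by
      intro a
      have h1 : (Sg z i p s a + G z i s p a) / (1 + ∑ b, G z i s p b) = Sg z i p s a :=
        (congrFun hz (Sum.inl (i, p, s, a))).trans (hSz i p s a).symm
      rw [div_eq_iff (by linarith [hGs0 z i s p])] at h1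
      linarith
    have e2 : ∑ a, Sg z i p s a * (Q z i s p a - W z i s p) = 0 := by
      have h1 : W z i s p = ∑ a, Sg z i p s a * Q z i s p a := hlin i s p (Sg z i)
      simp only [mul_sub]
      rw [Finset.sum_sub_distrib, ← Finset.sum_mul, (hSgp z i).2, ← h1]
      ring
    have e3 : ∑ a, G z i s p a ^ 2 = 0 := by
      have h1 : ∀ a, G z i s p a ^ 2 =
          (∑ b, G z i s p b) * (Sg z i p s a * (Q z i s p a - W z i s p)) := by
        intro a
        have : G z i s p a ^ 2 = G z i s p a * (Q z i s p a - W z i s p) := by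
          simp only [G]
          rcases le_total (Q z i s p a - W z i s p) 0 with h | h
          · rw [max_eq_left h]; ring
          · rw [max_eq_right h]; ring
        rw [this]
        nth_rewrite 1 [← e1 a]
        ring
      simp only [h1]
      rw [← Finset.mul_sum, e2, mul_zero]
    intro a
    have h1 := (Finset.sum_eq_zero_iff_of_nonneg (fun i _ => sq_nonneg _)).1 e3 a
      (Finset.mem_univ a)
    have h2 : G z i s p a = 0 := by simpa using h1
    have h3 : Q z i s p a - W z i s p ≤ G z i s p a := le_max_right _ _
    linarith
  refine ⟨Sg z, Vv z, hSgp z, hVz, ?_⟩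
  intro i s p τ hτ
  rw [hlin, hVz]
  calc ∑ a, τ p s a * Q z i s p a ≤ ∑ a, τ p s a * W z i s p :=
        Finset.sum_le_sum fun a _ => mul_le_mul_of_nonneg_left (hopt i s p a) (hτ.1 _ _ _)
    _ = W z i s p := by rw [← Finset.sum_mul, hτ.2, one_mul]
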